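/- The map φ : P_2 → W defined by φ(π)(k) = k for k ≤ 1 and φ(π)(k) = π(k) + 1 for k ≥ 2 is surjective, and for each ρ ∈ W the fiber φ⁻¹(ρ) equals P_2(ρ) = {π_{ρ,2}, π̂_{ρ,2}}, which has exactly two elements. -/

import Mathlib

/-- W': weakly increasing, ρ 0 = 0, steps at most 1. -/
def Wprime (ρ : ℕ → ℕ) : Prop :=
  Monotone ρ ∧ ρ 0 = 0 ∧ ∀ k, ρ (k + 1) ≤ ρ k + 1

/-- W = {ρ ∈ W' : ρ k ≥ min k 2}. -/
def Wset (ρ : ℕ → ℕ) : Prop :=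
  Wprime ρ ∧ ∀ k, min k 2 ≤ ρ k

/-- Standard numerical perversity of level n. -/
def Pn (n : ℕ) (p : ℕ → ℕ) : Prop :=
  p 0 = 0 ∧ 0 < p n ∧ p n < n ∧ Monotone p ∧ Monotone (fun k => k - p k)

/-- The perversity p⁺ₙ. -/
def piPlus (n : ℕ) (p : ℕ → ℕ) (k : ℕ) : ℕ :=
  if n - p n ≤ k - p k then p k + 1 else p k

/-- P_n(ρ). -/
def PnRho (n : ℕ) (ρ p : ℕ → ℕ) : Prop :=
  Pn n p ∧ (∀ k, piPlus n p k ≤ ρ k) ∧ ∀ k, n ≤ k → piPlus n p k = ρ k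

/-- The minimal element π_{ρ,n}. -/
def piMin (ρ : ℕ → ℕ) (n k : ℕ) : ℕ :=
  if k < n then k - (n - ρ n + 1) else ρ k - 1

/-- The map φ : P₂ → W. -/
def phi (p : ℕ → ℕ) (k : ℕ) : ℕ := if k ≤ 1 then k else p k + 1

/-- The maximal element π̂_{ρ,2}. -/
def piHat2 (ρ : ℕ → ℕ) (k : ℕ) : ℕ := if k ≤ 1 then k else ρ k - 1

theorem Wset.apply_one {ρ : ℕ → ℕ} (h : Wset ρ) : ρ 1 = 1 := by
  have h₁ := h.1.2.2 0
  have h₂ := h.2 1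
  have h₀ := h.1.2.1
  simp only [Nat.zero_add] at h₁
  omega

theorem Wset.apply_two {ρ : ℕ → ℕ} (h : Wset ρ) : ρ 2 = 2 := by
  have h₁ := h.1.2.2 1
  have h₂ := h.2 2
  have := h.apply_one
  simp only [Nat.reduceAdd] at h₁
  omega

theorem Wset.apply_le {ρ : ℕ → ℕ} (h : Wset ρ) (k : ℕ) : ρ k ≤ k := by
  induction k with
  | zero => exact h.1.2.1.le
  | succ k ih => exact (h.1.2.2 k).trans (Nat.succ_le_succ ih)

/-- Away from `k = 1`, where the value may be `0` or `1`, a perversity is determined by `ρ`. -/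
theorem pn_two_of_eq_pred {ρ p : ℕ → ℕ} (h : Wset ρ) (h0 : p 0 = 0) (h1 : p 1 ≤ 1)
    (hp : ∀ k, 2 ≤ k → p k = ρ k - 1) : Pn 2 p := by
  have h2 := h.apply_two
  have hp2 := hp 2 le_rfl
  refine ⟨h0, by omega, by omega, monotone_nat_of_le_succ fun k => ?_,
    monotone_nat_of_le_succ fun k => ?_⟩
  all_goals
    match k with
    | 0 => simp [h0]
    | 1 => simp only [Nat.reduceAdd]; omega
    | k + 2 =>
      have hk := hp (k + 2) (by omega)
      have hk' := hp (k + 2 + 1) (by omega)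
      have hle := h.apply_le (k + 2)
      have hmin := h.2 (k + 2)
      have hstep := h.1.2.2 (k + 2)
      have hmono := h.1.1 (Nat.le_succ (k + 2))
      simp only [Nat.succ_eq_add_one] at *
      omega

theorem Pn.apply_two {p : ℕ → ℕ} (h : Pn 2 p) : p 2 = 1 := by
  have := h.2.1
  have := h.2.2.1
  omega

theorem Pn.apply_one_le {p : ℕ → ℕ} (h : Pn 2 p) : p 1 ≤ 1 :=
  (h.2.2.2.1 one_le_two).trans h.apply_two.le

theorem Pn.piPlus_two {p : ℕ → ℕ} (h : Pn 2 p) {k : ℕ} (hk : 2 ≤ k) :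
    piPlus 2 p k = p k + 1 :=
  if_pos (h.2.2.2.2 hk)

theorem Pn.piPlus_two_eq_phi {p : ℕ → ℕ} (h : Pn 2 p) : piPlus 2 p = phi p := by
  have h0 := h.1
  have h1 := h.apply_one_le
  have h2 := h.apply_two
  funext k
  match k with
  | 0 => simp [piPlus, phi, h0, h2]
  | 1 =>
    simp only [piPlus, phi, h2]
    split_ifs <;> omega
  | k + 2 => simp [h.piPlus_two, phi]

theorem pn_and_phi_eq_iff_pnRho {ρ : ℕ → ℕ} (h : Wset ρ) (p : ℕ → ℕ) :
    (Pn 2 p ∧ phi p = ρ) ↔ PnRho 2 ρ p := by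
  refine and_congr_right fun hp => ?_
  rw [hp.piPlus_two_eq_phi]
  refine ⟨fun e => ⟨fun k => (congrFun e k).le, fun k _ => congrFun e k⟩, fun e => funext fun k => ?_⟩
  match k with
  | 0 => simp [phi, h.1.2.1]
  | 1 => simp [phi, h.apply_one]
  | k + 2 => exact e.2 _ (by omega)

theorem pn_and_phi_eq_iff {ρ : ℕ → ℕ} (h : Wset ρ) (p : ℕ → ℕ) :
    (Pn 2 p ∧ phi p = ρ) ↔ (p = piMin ρ 2 ∨ p = piHat2 ρ) := by
  have h2 := h.apply_two
  constructor
  · rintro ⟨hp, rfl⟩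
    have h0 := hp.1
    rcases Nat.le_one_iff_eq_zero_or_eq_one.1 hp.apply_one_le with h1 | h1
    · left
      funext k
      match k with
      | 0 => simp [piMin, h0]
      | 1 => simp [piMin, h1]
      | k + 2 => simp [piMin, phi]
    · right
      funext k
      match k with
      | 0 => simp [piHat2, h0]
      | 1 => simp [piHat2, h1]
      | k + 2 => simp [piHat2, phi]
  · intro e
    have h0 : p 0 = 0 := by rcases e with rfl | rfl <;> simp [piMin, piHat2]
    have h1 : p 1 ≤ 1 := by rcases e with rfl | rfl <;> simp [piMin, piHat2]
    have hp : ∀ k, 2 ≤ k → p k = ρ k - 1 := fun k hk => by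
      rcases e with rfl | rfl
      · exact if_neg (by omega)
      · exact if_neg (by omega)
    refine ⟨pn_two_of_eq_pred h h0 h1 hp, funext fun k => ?_⟩
    match k with
    | 0 => simp [phi, h.1.2.1]
    | 1 => simp [phi, h.apply_one]
    | k + 2 =>
      have := h.2 (k + 2)
      have := hp (k + 2) (by omega)
      simp only [phi, if_neg (show ¬ k + 2 ≤ 1 by omega)]
      omega

theorem phi_surjective_two_to_one :
    ∀ ρ : ℕ → ℕ, Wset ρ →
      (∃ p, Pn 2 p ∧ phi p = ρ) ∧
      (∀ p, (Pn 2 p ∧ phi p = ρ) ↔ PnRho 2 ρ p) ∧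
      (∀ p, PnRho 2 ρ p ↔ (p = piMin ρ 2 ∨ p = piHat2 ρ)) ∧
      piMin ρ 2 ≠ piHat2 ρ := by
  intro ρ h
  refine ⟨⟨piHat2 ρ, (pn_and_phi_eq_iff h _).2 (Or.inr rfl)⟩, pn_and_phi_eq_iff_pnRho h,
    fun p => (pn_and_phi_eq_iff_pnRho h p).symm.trans (pn_and_phi_eq_iff h p), fun e => ?_⟩
  simpa [piMin, piHat2] using congrFun e 1
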